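/- Let δ be a standard Gaussian random vector in R^d (law N(0, I_d)) with d ≥ 1, let T ≥ 2 be a real number, and let τ be any real number with τ ≥ 2d + 3 log T + d log log T. Then E[ ‖δ‖₂² · 1{‖δ‖₂² > τ} ] < 2d / T^{3/2}. -/

import Mathlib

open MeasureTheory ProbabilityTheory Finset

noncomputable section

/-- Standard Gaussian distribution `N(0, I_d)` on `R^d`. -/
def stdGaussian (d : ℕ) : Measure (Fin d → ℝ) := Measure.pi fun _ => gaussianReal 0 1

lemma aux_pi_density (d : ℕ) : (Measure.pi fun _ : Fin d => gaussianReal 0 1) =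
    (volume : Measure (Fin d → ℝ)).withDensity
      (fun x => ENNReal.ofReal (∏ i, gaussianPDFReal 0 1 (x i))) := by
  refine Measure.pi_eq (fun s hs => ?_)
  rw [withDensity_apply _ (MeasurableSet.univ_pi hs), volume_pi, Measure.restrict_pi_pi,
    ← ofReal_integral_eq_lintegral_ofReal]
  · rw [integral_fintype_prod_eq_prod (𝕜 := ℝ) (fun i => gaussianPDFReal 0 1)]
    rw [ENNReal.ofReal_prod_of_nonneg]
    · refine Finset.prod_congr rfl fun i _ => ?_
      rw [gaussianReal_apply_eq_integral 0 one_ne_zero]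
    · intro i _
      exact integral_nonneg (fun x => gaussianPDFReal_nonneg _ _ _)
  · exact Integrable.fintype_prod (fun i => (integrable_gaussianPDFReal 0 1).integrableOn)
  · exact Filter.Eventually.of_forall fun x => Finset.prod_nonneg fun i _ => gaussianPDFReal_nonneg _ _ _

lemma aux_prod_pdf (d : ℕ) (x : Fin d → ℝ) : ∏ i, gaussianPDFReal 0 1 (x i) =
    (√(2 * Real.pi))⁻¹ ^ d * Real.exp (-(∑ i, x i ^ 2) / 2) := by
  simp only [gaussianPDFReal, Finset.prod_mul_distrib]
  rw [← Real.exp_sum]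
  congr 1
  · simp
  · simp [Finset.sum_div, neg_div]

lemma aux_radial (d : ℕ) (hd : 1 ≤ d) (τ : ℝ) :
    ∫ x, Set.indicator {x : Fin d → ℝ | τ < ∑ i, (x i) ^ 2} (fun x => ∑ i, (x i) ^ 2) x
      ∂(Measure.pi fun _ : Fin d => gaussianReal 0 1) =
    (d / (√2 ^ d * Real.Gamma (d / 2 + 1))) * ∫ y in Set.Ioi (0 : ℝ), y ^ (d - 1) *
      (Real.exp (-y ^ 2 / 2) * Set.indicator {y : ℝ | τ < y ^ 2} (fun y => y ^ 2) y) := by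
  have : Nonempty (Fin d) := ⟨⟨0, hd⟩⟩
  rw [aux_pi_density, integral_withDensity_eq_integral_toReal_smul]
  rotate_left
  · simp only [aux_prod_pdf]
    fun_prop
  · simp
  let g : ℝ → ℝ := fun y => (√(2 * Real.pi))⁻¹ ^ d *
    (Real.exp (-y ^ 2 / 2) * Set.indicator {y : ℝ | τ < y ^ 2} (fun y => y ^ 2) y)
  have h1 := integral_fun_norm_addHaar (volume : Measure (EuclideanSpace ℝ (Fin d))) g
  rw [← (PiLp.volume_preserving_toLp (Fin d)).integral_comp
    (MeasurableEquiv.toLp 2 (Fin d → ℝ)).measurableEmbedding] at h1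
  have h2 : ∀ x : Fin d → ℝ, g ‖WithLp.toLp 2 x‖ =
      (ENNReal.ofReal (∏ i, gaussianPDFReal 0 1 (x i))).toReal •
        Set.indicator {x : Fin d → ℝ | τ < ∑ i, (x i) ^ 2} (fun x => ∑ i, (x i) ^ 2) x := by
    intro x
    have h3 : ‖(WithLp.toLp 2 x : EuclideanSpace ℝ (Fin d))‖ ^ 2 = ∑ i, x i ^ 2 := by
      simp [EuclideanSpace.norm_sq_eq]
    rw [ENNReal.toReal_ofReal (Finset.prod_nonneg fun i _ => gaussianPDFReal_nonneg _ _ _),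
      aux_prod_pdf]
    simp only [g, Set.indicator, Set.mem_ofPred_eq, h3, smul_eq_mul]
    ring
  simp only [h2] at h1
  rw [h1]
  simp only [g, finrank_euclideanSpace, Fintype.card_fin, smul_eq_mul, nsmul_eq_mul,
    Measure.real, EuclideanSpace.volume_ball]
  have hG : 0 < Real.Gamma ((d : ℝ) / 2 + 1) := Real.Gamma_pos_of_pos (by positivity)
  simp only [ENNReal.ofReal_one, one_pow, one_mul]
  rw [ENNReal.toReal_ofReal (by positivity)]
  have h4 : ∀ y : ℝ, y ^ (d - 1) * ((√(2 * Real.pi))⁻¹ ^ d *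
    (Real.exp (-y ^ 2 / 2) * Set.indicator {y : ℝ | τ < y ^ 2} (fun y => y ^ 2) y)) =
    (√(2 * Real.pi))⁻¹ ^ d * (y ^ (d - 1) * 
    (Real.exp (-y ^ 2 / 2) * Set.indicator {y : ℝ | τ < y ^ 2} (fun y => y ^ 2) y)) := by
    intro y; ring
  simp only [h4]
  rw [integral_const_mul]
  have hp : 0 < √Real.pi := by have := Real.pi_pos; positivity
  rw [Real.sqrt_mul (by norm_num)]
  simp only [← mul_assoc]
  congr 1
  rw [inv_pow, mul_pow]
  field_simp

lemma aux_tail (d : ℕ) (hd : 1 ≤ d) (τ t : ℝ) (h : t ≤ τ) (ht : d < t) :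
    ∫ y in Set.Ioi (0 : ℝ), y ^ (d - 1) *
      (Real.exp (-y ^ 2 / 2) * Set.indicator {y : ℝ | τ < y ^ 2} (fun y => y ^ 2) y)
    ≤ t / (t - d) * (√t ^ d * Real.exp (-t / 2)) := by
  have ht0 : 0 < t := lt_of_le_of_lt (by positivity) ht
  have htd : 0 < t - d := by linarith
  set c := t / (t - d) with hc
  have hcpos : 0 < c := by positivity
  let G : ℝ → ℝ := fun y => -(c * (y ^ d * Real.exp (-y ^ 2 / 2)))
  let G' : ℝ → ℝ := fun y => c * (y ^ (d + 1) - d * y ^ (d - 1)) * Real.exp (-y ^ 2 / 2)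
  have hder : ∀ y ∈ Set.Ici (√t), HasDerivAt G (G' y) y := by
    intro y _
    have h1 : HasDerivAt (fun y : ℝ => Real.exp (-y ^ 2 / 2)) (Real.exp (-y ^ 2 / 2) * (-y)) y := by
      have h0 : HasDerivAt (fun y : ℝ => -y ^ 2 / 2) (-y) y := by
        convert! ((hasDerivAt_pow 2 y).neg.div_const 2) using 1
        simp
        ring
      exact h0.exp
    have h2 := (((hasDerivAt_pow d y).mul h1).const_mul c).neg
    convert! h2 using 1
    simp only [G']
    ring
  have key : ∀ y, √t < y → y ^ (d + 1) * Real.exp (-y ^ 2 / 2) ≤ G' y := by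
    intro y hy
    have hy0 : 0 < y := lt_of_le_of_lt (Real.sqrt_nonneg _) hy
    have hy2 : t < y ^ 2 := (Real.sqrt_lt' hy0).1 hy
    obtain ⟨k, rfl⟩ : ∃ k, d = k + 1 := ⟨d - 1, by omega⟩
    simp only [G', Nat.add_sub_cancel]
    apply mul_le_mul_of_nonneg_right _ (Real.exp_pos _).le
    have : y ^ (k + 1 + 1) = y ^ k * y ^ 2 := by ring
    rw [this]
    have h5 : y ^ 2 ≤ c * (y ^ 2 - (k + 1 : ℕ)) := by
      rw [hc, div_mul_eq_mul_div, le_div_iff₀ htd]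
      have : (0 : ℝ) ≤ ((k + 1 : ℕ) : ℝ) := by positivity
      nlinarith
    calc y ^ k * y ^ 2 ≤ y ^ k * (c * (y ^ 2 - (k + 1 : ℕ))) := by gcongr
      _ = _ := by ring
  have hpos : ∀ y ∈ Set.Ioi (√t), 0 ≤ G' y := by
    intro y hy
    have hy0 : 0 < y := lt_of_le_of_lt (Real.sqrt_nonneg _) hy
    exact le_trans (by positivity) (key y hy)
  have hlim : Filter.Tendsto G Filter.atTop (nhds 0) := by
    have h1 := (rpow_mul_exp_neg_mul_sq_isLittleO_exp_neg (b := 1 / 2) (by norm_num) d)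
    have h2 : Filter.Tendsto (fun x : ℝ => Real.exp (-(1 / 2) * x)) Filter.atTop (nhds 0) := by
      refine Real.tendsto_exp_atBot.comp ?_
      exact Filter.tendsto_id.const_mul_atTop_of_neg (by norm_num)
    have h3 := ((h1.trans_tendsto h2).const_mul c).neg
    simp only [mul_zero, neg_zero] at h3
    refine h3.congr fun x => ?_
    simp only [G, Real.rpow_natCast]
    congr 4
    ring
  have hgint := integrableOn_Ioi_deriv_of_nonneg' hder hpos hlim
  have hval := integral_Ioi_of_hasDerivAt_of_nonneg' hder hpos hlim
  have hR : ∫ y in Set.Ioi (√t), G' y = c * (√t ^ d * Real.exp (-t / 2)) := by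
    rw [hval]; simp [G, Real.sq_sqrt ht0.le]
  rw [← hR, ← integral_indicator measurableSet_Ioi, ← integral_indicator measurableSet_Ioi]
  refine integral_mono_of_nonneg (Filter.Eventually.of_forall fun y => ?_)
    (hgint.integrable_indicator measurableSet_Ioi) (Filter.Eventually.of_forall fun y => ?_)
  · refine Set.indicator_nonneg (fun y (hy : 0 < y) => ?_) y
    have : 0 ≤ Set.indicator {y : ℝ | τ < y ^ 2} (fun y => y ^ 2) y :=
      Set.indicator_nonneg (fun y _ => sq_nonneg y) y
    positivity
  · by_cases hy : 0 < y
    · by_cases hy2 : τ < y ^ 2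
      · have hty : √t < y := (Real.sqrt_lt' hy).2 (by linarith)
        have := key y hty
        simp only [Set.indicator, Set.mem_Ioi, hy, hty, Set.mem_ofPred_eq, hy2, if_true]
        refine le_trans (le_of_eq ?_) this
        have e : d + 1 = (d - 1) + 2 := by omega
        rw [e, pow_add]; ring
      · have : 0 ≤ (Set.Ioi √t).indicator G' y := Set.indicator_nonneg hpos y
        simpa [Set.indicator, hy, hy2] using this
    · have : 0 ≤ (Set.Ioi √t).indicator G' y := Set.indicator_nonneg hpos y
      simpa [Set.indicator, hy] using this

lemma aux_step (x : ℝ) (hx : 1 ≤ x)  :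
    ((2.4 * (x + 2) + 3) / 2) ^ ((x + 2) / 2) * Real.exp (-(x + 2)) ≤
    (((2.4 * x + 3) / 2) ^ (x / 2) * Real.exp (-x)) * (x / 2 + 1) := by
  set a := (2.4 * x + 3) / 2 with ha
  have ha0 : 0 < a := by rw [ha]; positivity
  have hb : (2.4 * (x + 2) + 3) / 2 = a + 2.4 := by rw [ha]; ring
  rw [hb, show (x + 2) / 2 = x / 2 + 1 by ring, Real.rpow_add_one (by positivity)]
  have h1 : (a + 2.4) ^ (x / 2) ≤ a ^ (x / 2) * Real.exp (2.4 * x / (2.4 * x + 3)) := by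
    have : a + 2.4 = a * (1 + 2.4 / a) := by field_simp
    rw [this, Real.mul_rpow ha0.le (by positivity)]
    gcongr
    calc (1 + 2.4 / a) ^ (x / 2) ≤ (Real.exp (2.4 / a)) ^ (x / 2) := by
          apply Real.rpow_le_rpow (by positivity) _ (by positivity)
          linarith [Real.add_one_le_exp (2.4 / a)]
      _ = Real.exp (2.4 * x / (2.4 * x + 3)) := by
          rw [← Real.exp_mul]; congr 1; rw [ha]; field_simp
  have h2 : Real.exp (2.4 * x / (2.4 * x + 3)) * (a + 2.4) * Real.exp (-2) ≤ x / 2 + 1 := by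
    have e1 : Real.exp (2.4 * x / (2.4 * x + 3)) * Real.exp (-2) =
        (Real.exp 1 * Real.exp (3 / (2.4 * x + 3)))⁻¹ := by
      rw [← Real.exp_add, ← Real.exp_add, ← Real.exp_neg]; congr 1; field_simp; ring
    have e2 : 2.7 * (1 + 3 / (2.4 * x + 3)) ≤ Real.exp 1 * Real.exp (3 / (2.4 * x + 3)) := by
      have := Real.exp_one_gt_d9
      have := Real.add_one_le_exp (3 / (2.4 * x + 3))
      gcongr
      · linarith
      · linarith
    have e3 : a + 2.4 ≤ (x / 2 + 1) * (2.7 * (1 + 3 / (2.4 * x + 3))) := by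
      have : 1 + 3 / (2.4 * x + 3) = (2.4 * x + 6) / (2.4 * x + 3) := by field_simp; ring
      rw [this, ← mul_div_assoc, ← mul_div_assoc, le_div_iff₀ (by positivity), ha]
      nlinarith
    rw [mul_right_comm, e1, inv_mul_le_iff₀ (by positivity), mul_comm]
    exact e3.trans (by gcongr)
  calc (a + 2.4) ^ (x / 2) * (a + 2.4) * Real.exp (-(x + 2))
      ≤ (a ^ (x / 2) * Real.exp (2.4 * x / (2.4 * x + 3))) * (a + 2.4) * Real.exp (-(x + 2)) := by
        gcongr
    _ = (a ^ (x / 2) * Real.exp (-x)) * (Real.exp (2.4 * x / (2.4 * x + 3)) * (a + 2.4) * Real.exp (-2)) := by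
        rw [show -(x + 2) = -x + -2 by ring, Real.exp_add]; ring
    _ ≤ _ := by gcongr

lemma aux_gamma : ∀ d : ℕ, 1 ≤ d → ((2.4 * (d : ℝ) + 3) / 2) ^ ((d : ℝ) / 2) * Real.exp (-d) ≤
    0.7 * Real.Gamma (d / 2 + 1)
  | 0, h => by omega
  | 1, _ => by
    have h1 : Real.Gamma (((1 : ℕ) : ℝ) / 2 + 1) = √Real.pi / 2 := by
      rw [Real.Gamma_add_one (by norm_num)]
      push_cast
      rw [Real.Gamma_one_half_eq]; ring
    rw [h1, Real.exp_neg, ← div_eq_mul_inv, div_le_iff₀ (Real.exp_pos _)]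
    push_cast
    rw [← Real.sqrt_eq_rpow]
    have h2 : √((2.4 * 1 + 3) / 2 : ℝ) ≤ 1.65 := by
      rw [Real.sqrt_le_left (by norm_num)]; norm_num
    have h3 : 1.77 ≤ √Real.pi := by
      apply Real.le_sqrt_of_sq_le
      have := Real.pi_gt_d2
      norm_num at *; linarith
    have h4 := Real.exp_one_gt_d9
    nlinarith
  | 2, _ => by
    have h1 : Real.Gamma (((2 : ℕ) : ℝ) / 2 + 1) = 1 := by
      norm_num
    rw [h1, Real.exp_neg, ← div_eq_mul_inv, div_le_iff₀ (Real.exp_pos _)]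
    push_cast
    have h4 := Real.exp_one_gt_d9
    have h5 : Real.exp 2 = Real.exp 1 * Real.exp 1 := by rw [← Real.exp_add]; norm_num
    rw [h5, show (2 : ℝ) / 2 = 1 by norm_num, Real.rpow_one]
    nlinarith
  | (n + 3), _ => by
    have ih := aux_gamma (n + 1) (by omega)
    have hs := aux_step ((n + 1 : ℕ) : ℝ) (by push_cast; linarith [(Nat.cast_nonneg n : (0 : ℝ) ≤ n)])
    have e : ((n + 3 : ℕ) : ℝ) = ((n + 1 : ℕ) : ℝ) + 2 := by push_cast; ring
    rw [e]
    refine hs.trans ?_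
    set x := ((n + 1 : ℕ) : ℝ) with hx
    have hx0 : 0 ≤ x := by positivity
    rw [show (x + 2) / 2 + 1 = (x / 2 + 1) + 1 by ring, Real.Gamma_add_one (by positivity)]
    calc _ ≤ (0.7 * Real.Gamma (x / 2 + 1)) * (x / 2 + 1) := by gcongr
      _ = _ := by ring

lemma aux_final (d : ℕ) (hd : 1 ≤ d) (T t : ℝ) (hT : 2 ≤ T)
    (ht : t = 2 * d + 3 * Real.log T + d * Real.log (Real.log T)) :
    d < t ∧ (d / (√2 ^ d * Real.Gamma (d / 2 + 1))) * (t / (t - d) * (√t ^ d * Real.exp (-t / 2)))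
      < 2 * d / T ^ ((3 : ℝ) / 2) := by
  have hd' : (1 : ℝ) ≤ d := by exact_mod_cast hd
  have hd0 : (0 : ℝ) < d := by linarith
  have hT0 : 0 < T := by linarith
  set L := Real.log T with hL
  have hLl : 0.693 < L := by
    have h1 : Real.log 2 ≤ L := Real.log_le_log (by norm_num) hT
    have := Real.log_two_gt_d9
    norm_num at *; linarith
  have hL0 : 0 < L := by linarith
  have hl1 : -0.444 ≤ Real.log L := by
    have h1 := Real.one_sub_inv_le_log_of_pos hL0
    have h2 : L⁻¹ ≤ 1.444 := by
      rw [inv_le_comm₀ hL0 (by norm_num)]; norm_num at *; linarith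
    linarith
  have hl2 : 2 + Real.log L ≤ 2.4 * L := by
    have h1 : Real.log (L / 0.7) ≤ L / 0.7 - 1 := Real.log_le_sub_one_of_pos (by positivity)
    rw [Real.log_div hL0.ne' (by norm_num)] at h1
    have h2 : Real.log 0.7 ≤ -0.35 := by
      rw [Real.log_le_iff_le_exp (by norm_num), Real.exp_neg, le_inv_comm₀ (by norm_num) (Real.exp_pos _)]
      have h3 := Real.exp_bound' (x := 0.35) (by norm_num) (by norm_num) (n := 4) (by norm_num)
      refine h3.trans ?_
      norm_num [Finset.sum_range_succ, Nat.factorial]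
    norm_num at *
    linarith
  have htd : 0.556 * d ≤ t - d := by rw [ht]; nlinarith
  have hdt : d < t := by nlinarith
  refine ⟨hdt, ?_⟩
  have ht0 : 0 < t := by linarith
  have hG : 0 < Real.Gamma ((d : ℝ) / 2 + 1) := Real.Gamma_pos_of_pos (by positivity)
  have hfac : t / (t - d) ≤ 2.8 := by
    rw [div_le_iff₀ (by linarith)]; norm_num at *; linarith
  have hexp : Real.exp (-t / 2) = Real.exp (-d) * (T ^ ((3 : ℝ) / 2))⁻¹ * (L ^ ((d : ℝ) / 2))⁻¹ := by
    rw [Real.rpow_def_of_pos hT0, Real.rpow_def_of_pos hL0, ← Real.exp_neg, ← Real.exp_neg,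
      ← Real.exp_add, ← Real.exp_add, ht]
    congr 1; ring
  have hpow : √t ^ d = √2 ^ d * (t / 2) ^ ((d : ℝ) / 2) := by
    rw [Real.rpow_div_two_eq_sqrt _ (by positivity), Real.rpow_natCast, ← mul_pow,
      ← Real.sqrt_mul (by norm_num)]
    congr 2; ring
  have hbase : (t / 2) ^ ((d : ℝ) / 2) ≤ ((2.4 * (d : ℝ) + 3) / 2) ^ ((d : ℝ) / 2) * L ^ ((d : ℝ) / 2) := by
    rw [← Real.mul_rpow (by positivity) hL0.le]
    apply Real.rpow_le_rpow (by positivity) _ (by positivity)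
    rw [ht]
    nlinarith
  have hg := aux_gamma d hd
  have hLp : 0 < L ^ ((d : ℝ) / 2) := by positivity
  have hTp : 0 < T ^ ((3 : ℝ) / 2) := by positivity
  have hmain : (t / 2) ^ ((d : ℝ) / 2) * Real.exp (-d) * (L ^ ((d : ℝ) / 2))⁻¹ ≤
      0.7 * Real.Gamma (d / 2 + 1) := by
    refine le_trans ?_ hg
    rw [← div_eq_mul_inv, div_le_iff₀ hLp]
    calc _ ≤ (((2.4 * (d : ℝ) + 3) / 2) ^ ((d : ℝ) / 2) * L ^ ((d : ℝ) / 2)) * Real.exp (-d) := by gcongr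
      _ = _ := by ring
  rw [hpow, hexp]
  calc _ = d / T ^ ((3 : ℝ) / 2) * (t / (t - d) * (((t / 2) ^ ((d : ℝ) / 2) * Real.exp (-d) * (L ^ ((d : ℝ) / 2))⁻¹) / Real.Gamma (d / 2 + 1))) := by
        field_simp
    _ ≤ d / T ^ ((3 : ℝ) / 2) * (2.8 * 0.7) := by
        have : ((t / 2) ^ ((d : ℝ) / 2) * Real.exp (-d) * (L ^ ((d : ℝ) / 2))⁻¹) / Real.Gamma (d / 2 + 1) ≤ 0.7 := by
          rw [div_le_iff₀ hG]; exact hmain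
        gcongr
    _ < d / T ^ ((3 : ℝ) / 2) * 2 := by
        have : 0 < d / T ^ ((3 : ℝ) / 2) := by positivity
        gcongr; norm_num
    _ = _ := by ring

/-- truncated second-moment bound for a standard Gaussian vector. -/
theorem gaussian_truncated_moment {Ω : Type*} [MeasurableSpace Ω]
    (P : Measure Ω) [IsProbabilityMeasure P]
    (d : ℕ) (hd : 1 ≤ d) (δ : Ω → (Fin d → ℝ)) (hδ : Measurable δ)
    (hlaw : Measure.map δ P = stdGaussian d)
    (T τ : ℝ) (hT : 2 ≤ T)
    (hτ : 2 * d + 3 * Real.log T + d * Real.log (Real.log T) ≤ τ) :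
    ∫ ω, Set.indicator {ω | τ < ∑ i, (δ ω i) ^ 2} (fun ω => ∑ i, (δ ω i) ^ 2) ω ∂P
      < 2 * d / T ^ ((3 : ℝ) / 2) := by
  have hmeas : Measurable (fun x : Fin d → ℝ => ∑ i, (x i) ^ 2) := by fun_prop
  have hset : MeasurableSet {x : Fin d → ℝ | τ < ∑ i, (x i) ^ 2} :=
    measurableSet_lt measurable_const hmeas
  have h1 : ∫ ω, Set.indicator {ω | τ < ∑ i, (δ ω i) ^ 2} (fun ω => ∑ i, (δ ω i) ^ 2) ω ∂P =
      ∫ x, Set.indicator {x : Fin d → ℝ | τ < ∑ i, (x i) ^ 2} (fun x => ∑ i, (x i) ^ 2) x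
        ∂(Measure.map δ P) := by
    rw [integral_map hδ.aemeasurable (hmeas.indicator hset).aestronglyMeasurable]
    rfl
  obtain ⟨h2, h3⟩ := aux_final d hd T _ hT rfl
  rw [h1, hlaw, show _root_.stdGaussian d = Measure.pi fun _ => gaussianReal 0 1 from rfl,
    aux_radial d hd τ]
  refine lt_of_le_of_lt ?_ h3
  have hG : 0 < Real.Gamma ((d : ℝ) / 2 + 1) := Real.Gamma_pos_of_pos (by positivity)
  exact mul_le_mul_of_nonneg_left (aux_tail d hd τ _ hτ h2) (by positivity)

end
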